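/- arXiv:1209.6120 — 2 statements merged into one kernel-verified Lean document; each statement's English description precedes it below -/
import Mathlib

section
/- The function y ↦ N_f^{loc}(y) is Lebesgue measurable and ∫_ℝ N_f^{loc}(y) dy = 1. Consequently, the average number of local level sets contained in a level set of f, namely N̄_f^{loc} = h_f^{−1} ∫_ℝ N_f^{loc}(y) dy where h_f = height(f), equals h_f^{−1}, and in particular 3/2 ≤ N̄_f^{loc} ≤ 2. -/
/-- `phi x` is the distance from `x` to the nearest integer. -/
noncomputable def phi (x : ℝ) : ℝ := |x - round x|

/-- The signed Takagi function associated to the sign sequence `r`. -/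
noncomputable def takagi (r : ℕ → ℝ) (x : ℝ) : ℝ :=
  ∑' n : ℕ, r n / 2 ^ n * phi (2 ^ n * x)

/-- The height of the graph of the signed Takagi function `f_r`:
`height(f) = max_{x ∈ [0,1]} f(x) - min_{x ∈ [0,1]} f(x)` (the function is
continuous, so the sup and inf over `[0,1]` are attained). -/
noncomputable def heightf (r : ℕ → ℝ) : ℝ :=
  sSup (takagi r '' Set.Icc 0 1) - sInf (takagi r '' Set.Icc 0 1)

/-- `eps n x` is the `n`-th binary digit of `x ∈ [0,1)` (for `n ≥ 1`), using the
terminating expansion for dyadic rationals. -/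
noncomputable def eps (n : ℕ) (x : ℝ) : ℕ := (⌊2 ^ n * x⌋ % 2).toNat

/-- `Dfun r k x = ∑_{j=1}^k r_{j-1} (-1)^{ε_j(x)}`. -/
noncomputable def Dfun (r : ℕ → ℝ) (k : ℕ) (x : ℝ) : ℝ :=
  ∑ j ∈ Finset.Icc 1 k, r (j - 1) * (-1 : ℝ) ^ eps j x

open MeasureTheory ENNReal

/-- The collection of local level sets (equivalence classes of the relation
`x ∼ x' ↔ |D_j(x)| = |D_j(x')| for all j ≥ 1` on `[0,1)`) that are contained in
the level set `L_f(y)`. -/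
noncomputable def localLevelSetsIn (r : ℕ → ℝ) (y : ℝ) : Set (Set ℝ) :=
  {C | (∃ x ∈ Set.Ico (0 : ℝ) 1,
          C = {x' ∈ Set.Ico (0 : ℝ) 1 | ∀ j, 1 ≤ j → |Dfun r j x'| = |Dfun r j x|}) ∧
       C ⊆ {x : ℝ | x ∈ Set.Icc (0 : ℝ) 1 ∧ takagi r x = y}}
section

lemma phi_nonneg (x : ℝ) : 0 ≤ phi x := abs_nonneg _

lemma phi_le_half (x : ℝ) : phi x ≤ 1 / 2 := abs_sub_round x

lemma continuous_phi : Continuous phi := by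
  have h : phi = fun x : ℝ => ‖(x : UnitAddCircle)‖ := by
    ext x
    rw [UnitAddCircle.norm_eq]
    rfl
  rw [h]
  exact continuous_norm.comp (AddCircle.continuous_mk' 1)

lemma phi_eq_abs_sub {x : ℝ} {m : ℤ} (h : |x - m| ≤ 1 / 2) : phi x = |x - m| := by
  refine le_antisymm (round_le x m) ?_
  by_cases hm : round x = m
  · rw [phi, hm]
  · have h1 : (1 : ℝ) ≤ |(round x : ℝ) - m| := by
      exact_mod_cast Int.one_le_abs (sub_ne_zero.mpr hm)
    have h2 : |(round x : ℝ) - m| ≤ |x - m| + |x - round x| := by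
      rw [abs_sub_comm x (round x)]
      calc |(round x : ℝ) - m| = |(x - m) + (round x - x)| := by ring_nf
        _ ≤ _ := abs_add_le _ _
    unfold phi
    linarith

lemma phi_natCast (n : ℕ) : phi n = 0 := by simp [phi]

lemma phi_natCast_add_half (n : ℕ) : phi (n + 1 / 2) = 1 / 2 := by
  have h : |((n : ℝ) + 1 / 2) - ((n : ℤ) : ℝ)| = 1 / 2 := by
    push_cast
    rw [add_sub_cancel_left, abs_of_nonneg (by norm_num)]
  rw [phi_eq_abs_sub h.le, h]

lemma phi_midpoint {a b : ℝ} {j : ℤ} (ha : (j : ℝ) / 2 ≤ a) (ha' : a ≤ (j + 1) / 2)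
    (hb : (j : ℝ) / 2 ≤ b) (hb' : b ≤ (j + 1) / 2) :
    phi ((a + b) / 2) = (phi a + phi b) / 2 := by
  rcases Int.even_or_odd' j with ⟨m, rfl | rfl⟩
  · push_cast at *
    have key : ∀ x : ℝ, 2 * (m : ℝ) / 2 ≤ x → x ≤ (2 * m + 1) / 2 → phi x = x - m := by
      intro x h1 h2
      have h3 : |x - m| = x - m := abs_of_nonneg (by linarith)
      rw [phi_eq_abs_sub (m := m) (by rw [h3]; linarith), h3]
    rw [key a ha ha', key b hb hb', key _ (by linarith) (by linarith)]
    ring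
  · push_cast at *
    have key : ∀ x : ℝ, (2 * (m : ℝ) + 1) / 2 ≤ x → x ≤ (2 * m + 1 + 1) / 2 →
        phi x = m + 1 - x := by
      intro x h1 h2
      have h3 : |x - ((m + 1 : ℤ) : ℝ)| = m + 1 - x := by
        push_cast
        rw [abs_of_nonpos (by linarith)]
        ring
      rw [phi_eq_abs_sub (m := m + 1) (by rw [h3]; linarith), h3]
    rw [key a ha ha', key b hb hb', key _ (by linarith) (by linarith)]
    ring

lemma phi_two_mul_le (t : ℝ) : phi (2 * t) ≤ 2 * phi t := by
  have h := round_le (2 * t) (2 * round t)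
  push_cast at h
  rw [← mul_sub, abs_mul, abs_of_pos (two_pos : (0 : ℝ) < 2)] at h
  exact h

lemma phi_two_mul_le_one_sub (t : ℝ) : phi (2 * t) ≤ 1 - 2 * phi t := by
  have ht := abs_le.mp (abs_sub_round t)
  unfold phi
  rcases le_total 0 (t - round t) with h | h
  · have h1 := round_le (2 * t) (2 * round t + 1)
    rw [abs_of_nonneg h]
    push_cast at h1
    rw [abs_of_nonpos (a := 2 * t - (2 * (round t : ℝ) + 1)) (by linarith)] at h1
    linarith
  · have h1 := round_le (2 * t) (2 * round t - 1)
    rw [abs_of_nonpos h]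
    push_cast at h1
    rw [abs_of_nonneg (a := 2 * t - (2 * (round t : ℝ) - 1)) (by linarith)] at h1
    linarith

variable {r : ℕ → ℝ}

lemma norm_takagi_term_le (hr : ∀ n, r n = 1 ∨ r n = -1) (n : ℕ) (x : ℝ) :
    ‖r n / 2 ^ n * phi (2 ^ n * x)‖ ≤ (1 / 2) ^ n := by
  have h : |r n| = 1 := by rcases hr n with h | h <;> simp [h]
  rw [Real.norm_eq_abs, abs_mul, abs_div, h, abs_of_nonneg (phi_nonneg _), abs_of_pos (by positivity),
    one_div_pow]
  have := phi_le_half (2 ^ n * x)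
  exact mul_le_of_le_one_right (by positivity) (by linarith)

lemma summable_takagi_term (hr : ∀ n, r n = 1 ∨ r n = -1) (x : ℝ) :
    Summable fun n => r n / 2 ^ n * phi (2 ^ n * x) :=
  Summable.of_norm_bounded summable_geometric_two fun n => norm_takagi_term_le hr n x

lemma continuous_takagi (hr : ∀ n, r n = 1 ∨ r n = -1) : Continuous (takagi r) := by
  refine continuous_tsum (fun n => ?_) summable_geometric_two fun n x => norm_takagi_term_le hr n x
  have := continuous_phi
  fun_prop

lemma takagi_zero : takagi r 0 = 0 := by
  simp [takagi, phi]

lemma takagi_dyadic (r : ℕ → ℝ) {k K : ℕ} (h : k ≤ K) (i : ℕ) :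
    takagi r (i / 2 ^ k) = ∑ n ∈ Finset.range K, r n / 2 ^ n * phi (2 ^ n * (i / 2 ^ k)) := by
  refine tsum_eq_sum fun n hn => ?_
  have hk : k ≤ n := h.trans (by simpa using hn)
  have : (2 : ℝ) ^ n * (i / 2 ^ k) = ((2 ^ (n - k) * i : ℕ) : ℝ) := by
    push_cast
    rw [pow_sub₀ _ two_ne_zero hk]
    field_simp
  rw [this, phi_natCast, mul_zero]

lemma phi_dyadic_midpoint {n k : ℕ} (h : n < k) (i : ℕ) :
    phi (2 ^ n * ((2 * i + 1 : ℕ) / 2 ^ (k + 1))) =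
      (phi (2 ^ n * (i / 2 ^ k)) + phi (2 ^ n * ((i + 1 : ℕ) / 2 ^ k))) / 2 := by
  obtain ⟨d, rfl⟩ := Nat.exists_eq_add_of_lt h
  have e : ∀ c : ℝ, 2 ^ n * (c / 2 ^ (n + d + 1)) = c / 2 ^ d / 2 := by
    intro c
    rw [pow_add, pow_add]
    field_simp
  have h1 : ((i / 2 ^ d : ℕ) : ℝ) ≤ i / 2 ^ d := by
    simpa using Nat.cast_div_le (m := i) (n := 2 ^ d) (α := ℝ)
  have h2 : ((i + 1 : ℕ) : ℝ) / 2 ^ d ≤ (i / 2 ^ d : ℕ) + 1 := by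
    rw [div_le_iff₀ (by positivity)]
    exact_mod_cast (Nat.lt_div_mul_add (a := i) (b := 2 ^ d) (by positivity)).trans_eq
      (by ring : _ = (i / 2 ^ d + 1) * 2 ^ d)
  have h3 : (i : ℝ) / 2 ^ d ≤ ((i + 1 : ℕ) : ℝ) / 2 ^ d := by
    gcongr
    linarith
  rw [e, e, ← phi_midpoint (j := (i / 2 ^ d : ℕ))]
  · congr 1
    rw [pow_add, pow_add, pow_add]
    push_cast
    field_simp
    ring
  all_goals simp only [Int.cast_natCast]; linarith

lemma takagi_dyadic_midpoint (r : ℕ → ℝ) (k i : ℕ) :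
    takagi r ((2 * i + 1 : ℕ) / 2 ^ (k + 1)) =
      (takagi r (i / 2 ^ k) + takagi r ((i + 1 : ℕ) / 2 ^ k)) / 2 + r k / 2 ^ (k + 1) := by
  rw [takagi_dyadic r le_rfl, takagi_dyadic r le_rfl, takagi_dyadic r le_rfl,
    Finset.sum_range_succ, ← Finset.sum_add_distrib, Finset.sum_div]
  congr 1
  · refine Finset.sum_congr rfl fun n hn => ?_
    rw [phi_dyadic_midpoint (Finset.mem_range.mp hn)]
    ring
  · have : (2 : ℝ) ^ k * ((2 * i + 1 : ℕ) / 2 ^ (k + 1)) = i + 1 / 2 := by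
      rw [pow_succ]
      push_cast
      field_simp
    rw [this, phi_natCast_add_half, pow_succ]
    ring

lemma takagi_sub_takagi_le (hr : ∀ n, r n = 1 ∨ r n = -1) (x y : ℝ) :
    takagi r x - takagi r y ≤ 2 / 3 := by
  have block : ∀ n : ℕ, ∀ x y : ℝ,
      (r (2 * n) * phi x + r (2 * n + 1) / 2 * phi (2 * x)) -
        (r (2 * n) * phi y + r (2 * n + 1) / 2 * phi (2 * y)) ≤ 1 / 2 := by
    intro n x y
    have := phi_two_mul_le x
    have := phi_two_mul_le y
    have := phi_two_mul_le_one_sub x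
    have := phi_two_mul_le_one_sub y
    have := phi_nonneg (2 * x)
    have := phi_nonneg (2 * y)
    rcases hr (2 * n) with h | h <;> rcases hr (2 * n + 1) with h' | h' <;> rw [h, h'] <;> linarith
  obtain ⟨t, ht⟩ : ∃ t : ℕ → ℝ, ∀ n, t n =
      r n / 2 ^ n * phi (2 ^ n * x) - r n / 2 ^ n * phi (2 ^ n * y) := ⟨_, fun _ => rfl⟩
  have hsum : HasSum t (takagi r x - takagi r y) := by
    rw [funext ht]
    exact (summable_takagi_term hr x).hasSum.sub (summable_takagi_term hr y).hasSum
  have heven : Summable fun n => t (2 * n) :=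
    hsum.summable.comp_injective (mul_right_injective₀ two_ne_zero)
  have hodd : Summable fun n => t (2 * n + 1) :=
    hsum.summable.comp_injective
      ((add_left_injective 1).comp (mul_right_injective₀ (two_ne_zero (α := ℕ))))
  have hadd := HasSum.even_add_odd (f := t) heven.hasSum hodd.hasSum
  rw [hsum.unique hadd, ← heven.tsum_add hodd]
  have hgeo : HasSum (fun n : ℕ => 1 / 2 * (1 / 4 : ℝ) ^ n) (2 / 3) := by
    have := (hasSum_geometric_of_lt_one (r := (1 / 4 : ℝ)) (by norm_num) (by norm_num)).mul_left (1 / 2)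
    rwa [show 1 / 2 * (1 - 1 / 4 : ℝ)⁻¹ = 2 / 3 by norm_num] at this
  rw [← hgeo.tsum_eq]
  refine (heven.add hodd).tsum_le_tsum (fun n => ?_) hgeo.summable
  have key : ∀ z : ℝ, r (2 * n) / 2 ^ (2 * n) * phi (2 ^ (2 * n) * z) +
      r (2 * n + 1) / 2 ^ (2 * n + 1) * phi (2 ^ (2 * n + 1) * z) =
      (1 / 4) ^ n * (r (2 * n) * phi (2 ^ (2 * n) * z) +
        r (2 * n + 1) / 2 * phi (2 * (2 ^ (2 * n) * z))) := by
    intro z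
    rw [pow_succ' 2 (2 * n), mul_assoc 2, one_div_pow, pow_mul, show (2 : ℝ) ^ 2 = 4 by norm_num]
    field_simp
  calc _ = (1 / 4 : ℝ) ^ n * ((r (2 * n) * phi (2 ^ (2 * n) * x) +
        r (2 * n + 1) / 2 * phi (2 * (2 ^ (2 * n) * x))) - (r (2 * n) * phi (2 ^ (2 * n) * y) +
        r (2 * n + 1) / 2 * phi (2 * (2 ^ (2 * n) * y)))) := by
        rw [mul_sub, ← key, ← key, ht, ht]
        ring
    _ ≤ (1 / 4 : ℝ) ^ n * (1 / 2) := mul_le_mul_of_nonneg_left (block n _ _) (by positivity)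
    _ = _ := mul_comm _ _

lemma bddAbove_takagi (hr : ∀ n, r n = 1 ∨ r n = -1) : BddAbove (takagi r '' Set.Icc 0 1) := by
  refine ⟨2 / 3, ?_⟩
  rintro _ ⟨x, -, rfl⟩
  simpa [takagi_zero] using takagi_sub_takagi_le hr x 0

lemma bddBelow_takagi (hr : ∀ n, r n = 1 ∨ r n = -1) : BddBelow (takagi r '' Set.Icc 0 1) := by
  refine ⟨-(2 / 3), ?_⟩
  rintro _ ⟨x, -, rfl⟩
  have := takagi_sub_takagi_le hr 0 x
  rw [takagi_zero] at this
  linarith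

lemma half_le_heightf (hr : ∀ n, r n = 1 ∨ r n = -1) : 1 / 2 ≤ heightf r := by
  have hhalf : takagi r (1 / 2) = r 0 / 2 := by
    have h := takagi_dyadic_midpoint r 0 0
    have h1 := takagi_dyadic r (le_refl 0) 1
    simp only [zero_add, mul_zero, pow_zero, div_one, pow_one, Nat.cast_zero, Nat.cast_one,
      Finset.range_zero, Finset.sum_empty] at h h1
    rw [h, h1, takagi_zero]
    ring
  have m0 : takagi r 0 ∈ takagi r '' Set.Icc 0 1 := ⟨0, by simp, rfl⟩
  have m1 : takagi r (1 / 2) ∈ takagi r '' Set.Icc 0 1 := ⟨1 / 2, by norm_num, rfl⟩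
  have a0 := le_csSup (bddAbove_takagi hr) m0
  have a1 := le_csSup (bddAbove_takagi hr) m1
  have b0 := csInf_le (bddBelow_takagi hr) m0
  have b1 := csInf_le (bddBelow_takagi hr) m1
  rw [takagi_zero] at a0 b0
  rw [hhalf] at a1 b1
  unfold heightf
  rcases hr 0 with h | h <;> rw [h] at a1 b1 <;> linarith

lemma heightf_le (hr : ∀ n, r n = 1 ∨ r n = -1) : heightf r ≤ 2 / 3 := by
  have hne : (takagi r '' Set.Icc 0 1).Nonempty := ⟨_, 0, by simp, rfl⟩
  rw [heightf, sub_le_iff_le_add]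
  refine csSup_le hne ?_
  rintro _ ⟨x, -, rfl⟩
  rw [← sub_le_iff_le_add']
  refine le_csInf hne ?_
  rintro _ ⟨y, -, rfl⟩
  have := takagi_sub_takagi_le hr x y
  linarith

end

section

open Filter Topology

/-- The slope of the `k`-th partial sum of the signed Takagi function on the dyadic interval
`[i / 2 ^ k, (i + 1) / 2 ^ k]`. -/
def dySlope (R : ℕ → ℤ) : ℕ → ℕ → ℤ
  | 0, _ => 0
  | k + 1, i => dySlope R k (i / 2) + R k * (-1) ^ i

/-- The dyadic interval `[i / 2 ^ k, (i + 1) / 2 ^ k]` and all its dyadic ancestors have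
nonnegative slope. -/
def Survives (R : ℕ → ℤ) : ℕ → ℕ → Prop
  | 0, _ => True
  | k + 1, i => Survives R k (i / 2) ∧ 0 ≤ dySlope R (k + 1) i

/-- The index of the dyadic interval of level `k` containing `x`. -/
noncomputable def dyadicIndex (k : ℕ) (x : ℝ) : ℕ := ⌊2 ^ k * x⌋₊

/-- The value of the signed Takagi function at the dyadic point `i / 2 ^ k`. -/
noncomputable def node (R : ℕ → ℤ) (k i : ℕ) : ℝ := takagi (fun n => (R n : ℝ)) (i / 2 ^ k)

/-- The mean of the endpoint values on the dyadic interval `[i / 2 ^ k, (i + 1) / 2 ^ k]`. -/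
noncomputable def chordMid (R : ℕ → ℤ) (k i : ℕ) : ℝ := (node R k i + node R k (i + 1)) / 2

variable {R : ℕ → ℤ}

lemma cast_sign (hR : ∀ n, R n = 1 ∨ R n = -1) (n : ℕ) : (R n : ℝ) = 1 ∨ (R n : ℝ) = -1 := by
  rcases hR n with h | h <;> simp [h]

lemma dySlope_succ (k i : ℕ) : dySlope R (k + 1) i = dySlope R k (i / 2) + R k * (-1) ^ i := rfl

lemma dySlope_left (k i : ℕ) : dySlope R (k + 1) (2 * i) = dySlope R k i + R k := by
  rw [dySlope_succ, (even_two_mul i).neg_one_pow, Nat.mul_div_cancel_left _ two_pos, mul_one]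

lemma dySlope_right (k i : ℕ) : dySlope R (k + 1) (2 * i + 1) = dySlope R k i - R k := by
  rw [dySlope_succ, (odd_two_mul_add_one i).neg_one_pow, show (2 * i + 1) / 2 = i by omega]
  ring

lemma dySlope_succ_eq (hR : ∀ n, R n = 1 ∨ R n = -1) (k i : ℕ) :
    dySlope R (k + 1) i = dySlope R k (i / 2) + 1 ∨ dySlope R (k + 1) i = dySlope R k (i / 2) - 1 := by
  rw [dySlope_succ]
  rcases hR k with h | h <;> rcases neg_one_pow_eq_or ℤ i with h' | h' <;> simp [h, h'] <;> omega

lemma Survives.dySlope_nonneg {k i : ℕ} (h : Survives R k i) : 0 ≤ dySlope R k i := by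
  cases k with
  | zero => exact le_rfl
  | succ k => exact h.2

lemma Survives.ancestor {k m i : ℕ} (h : Survives R (k + m) i) : Survives R k (i / 2 ^ m) := by
  induction m generalizing i with
  | zero => simpa using h
  | succ m ih =>
    have := ih h.1
    rwa [Nat.div_div_eq_div_mul, ← pow_succ'] at this

lemma node_left (k i : ℕ) : node R (k + 1) (2 * i) = node R k i := by
  unfold node
  congr 1
  push_cast
  rw [pow_succ]
  field_simp

lemma node_right (k i : ℕ) : node R (k + 1) (2 * i + 1) = chordMid R k i + R k / 2 ^ (k + 1) :=
  takagi_dyadic_midpoint _ k i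

lemma node_add_one_sub (k i : ℕ) (hi : i < 2 ^ k) :
    node R k (i + 1) - node R k i = dySlope R k i / 2 ^ k := by
  induction k generalizing i with
  | zero =>
    obtain rfl : i = 0 := by simpa using hi
    simp [node, dySlope, takagi_zero,
      show takagi (fun n => (R n : ℝ)) 1 = 0 by simpa using takagi_dyadic _ (le_refl 0) 1]
  | succ k ih =>
    have hlt : i / 2 < 2 ^ k := by rw [pow_succ] at hi; omega
    have h := ih (i / 2) hlt
    have e : (2 : ℝ) ^ (k + 1) = 2 * 2 ^ k := pow_succ' _ _
    have hp : (0 : ℝ) < 2 ^ k := by positivity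
    rcases Nat.even_or_odd' i with ⟨c, rfl | rfl⟩
    · rw [Nat.mul_div_cancel_left _ two_pos] at h
      rw [node_left, node_right, dySlope_left, chordMid, e]
      push_cast
      have : node R k (c + 1) = node R k c + dySlope R k c / 2 ^ k := by linarith
      rw [this]
      field_simp
      ring
    · rw [show (2 * c + 1) / 2 = c by omega] at h
      rw [show 2 * c + 1 + 1 = 2 * (c + 1) by ring, node_left, node_right, dySlope_right, chordMid, e]
      push_cast
      have : node R k (c + 1) = node R k c + dySlope R k c / 2 ^ k := by linarith
      rw [this]
      field_simp
      ring

lemma chordMid_succ (hR : ∀ n, R n = 1 ∨ R n = -1) (k i : ℕ) (hi : i < 2 ^ (k + 1)) :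
    chordMid R (k + 1) i = chordMid R k (i / 2) +
      R k * (1 - dySlope R k (i / 2) * (dySlope R (k + 1) i - dySlope R k (i / 2))) / 2 ^ (k + 2) := by
  have hlt : i / 2 < 2 ^ k := by rw [pow_succ] at hi; omega
  have h := node_add_one_sub (R := R) k (i / 2) hlt
  have e1 : (2 : ℝ) ^ (k + 1) = 2 * 2 ^ k := pow_succ' _ _
  have e2 : (2 : ℝ) ^ (k + 2) = 4 * 2 ^ k := by rw [pow_add]; ring
  have hp : (0 : ℝ) < 2 ^ k := by positivity
  have hsq : (R k : ℝ) * R k = 1 := by rcases hR k with h | h <;> simp [h]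
  rcases Nat.even_or_odd' i with ⟨c, rfl | rfl⟩
  · rw [Nat.mul_div_cancel_left _ two_pos] at h ⊢
    have h' : node R k (c + 1) = node R k c + dySlope R k c / 2 ^ k := by linarith
    rw [chordMid, node_left, node_right, dySlope_left, chordMid, h', e1, e2]
    push_cast
    field_simp
    linear_combination (4 * (dySlope R k c : ℝ)) * hsq
  · rw [show (2 * c + 1) / 2 = c by omega] at h ⊢
    have h' : node R k (c + 1) = node R k c + dySlope R k c / 2 ^ k := by linarith
    rw [chordMid, show 2 * c + 1 + 1 = 2 * (c + 1) by ring, node_left, node_right, dySlope_right,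
      chordMid, h', e1, e2]
    push_cast
    field_simp
    linear_combination (-4 * (dySlope R k c : ℝ)) * hsq

lemma dySlope_mul_dySlope_succ (hR : ∀ n, R n = 1 ∨ R n = -1) (k i : ℕ) :
    dySlope R k (i / 2) * dySlope R (k + 1) i = |dySlope R k (i / 2)| * |dySlope R (k + 1) i| := by
  rw [← abs_mul, eq_comm, abs_eq_self]
  rcases dySlope_succ_eq hR k i with h | h <;> rw [h]
  · rcases le_or_gt 0 (dySlope R k (i / 2)) with h0 | h0
    · positivity
    · exact mul_nonneg_of_nonpos_of_nonpos h0.le (by omega)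
  · rcases le_or_gt (dySlope R k (i / 2)) 0 with h0 | h0
    · exact mul_nonneg_of_nonpos_of_nonpos h0 (by omega)
    · exact mul_nonneg h0.le (by omega)

/-- A sequence of indices of nested dyadic intervals. -/
structure IsBranch (c : ℕ → ℕ) : Prop where
  zero : c 0 = 0
  half : ∀ k, c (k + 1) / 2 = c k

namespace IsBranch

variable {c d : ℕ → ℕ}

lemma lt (hc : IsBranch c) (k : ℕ) : c k < 2 ^ k := by
  induction k with
  | zero => simp [hc.zero]
  | succ k ih =>
    have := hc.half k
    rw [pow_succ]
    omega

lemma left_mono (hc : IsBranch c) : Monotone fun k => (c k : ℝ) / 2 ^ k := by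
  refine monotone_nat_of_le_succ fun k => ?_
  have : (2 * c k : ℝ) ≤ c (k + 1) := by exact_mod_cast (by have := hc.half k; omega)
  rw [pow_succ', div_le_div_iff₀ (by positivity) (by positivity)]
  nlinarith [show (0 : ℝ) < 2 ^ k by positivity]

lemma right_anti (hc : IsBranch c) : Antitone fun k => ((c k : ℝ) + 1) / 2 ^ k := by
  refine antitone_nat_of_succ_le fun k => ?_
  have : (c (k + 1) + 1 : ℝ) ≤ 2 * (c k + 1) := by exact_mod_cast (by have := hc.half k; omega)
  rw [pow_succ', div_le_div_iff₀ (by positivity) (by positivity)]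
  nlinarith [show (0 : ℝ) < 2 ^ k by positivity]

lemma exists_point (hc : IsBranch c) :
    ∃ x : ℝ, ∀ k, (c k : ℝ) / 2 ^ k ≤ x ∧ x ≤ ((c k + 1 : ℕ) : ℝ) / 2 ^ k := by
  have key : ∀ j k, (c j : ℝ) / 2 ^ j ≤ ((c k : ℝ) + 1) / 2 ^ k := by
    intro j k
    calc (c j : ℝ) / 2 ^ j ≤ c (max j k) / 2 ^ (max j k) := hc.left_mono (le_max_left _ _)
      _ ≤ (c (max j k) + 1) / 2 ^ (max j k) := by gcongr; linarith
      _ ≤ _ := hc.right_anti (le_max_right _ _)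
  have hb : BddAbove (Set.range fun k => (c k : ℝ) / 2 ^ k) :=
    ⟨_, Set.forall_mem_range.mpr fun j => key j 0⟩
  refine ⟨⨆ k, (c k : ℝ) / 2 ^ k, fun k => ⟨le_ciSup hb k, ?_⟩⟩
  push_cast
  exact ciSup_le fun j => key j k

lemma tendsto_left {x : ℝ}
    (h : ∀ k, (c k : ℝ) / 2 ^ k ≤ x ∧ x ≤ ((c k + 1 : ℕ) : ℝ) / 2 ^ k) :
    Tendsto (fun k => (c k : ℝ) / 2 ^ k) atTop (𝓝 x) := by
  have h0 : Tendsto (fun k : ℕ => x - (1 / 2 : ℝ) ^ k) atTop (𝓝 (x - 0)) :=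
    tendsto_const_nhds.sub (tendsto_pow_atTop_nhds_zero_of_lt_one (by norm_num) (by norm_num))
  rw [sub_zero] at h0
  refine tendsto_of_tendsto_of_tendsto_of_le_of_le h0 tendsto_const_nhds (fun k => ?_)
    fun k => (h k).1
  have := (h k).2
  push_cast at this
  rw [add_div, ← one_div_pow] at this
  dsimp only
  linarith

lemma tendsto_right {x : ℝ}
    (h : ∀ k, (c k : ℝ) / 2 ^ k ≤ x ∧ x ≤ ((c k + 1 : ℕ) : ℝ) / 2 ^ k) :
    Tendsto (fun k => ((c k + 1 : ℕ) : ℝ) / 2 ^ k) atTop (𝓝 x) := by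
  have h0 : Tendsto (fun k : ℕ => (1 / 2 : ℝ) ^ k) atTop (𝓝 0) :=
    tendsto_pow_atTop_nhds_zero_of_lt_one (by norm_num) (by norm_num)
  have h1 := (tendsto_left h).add h0
  rw [add_zero] at h1
  refine h1.congr fun k => ?_
  push_cast
  rw [add_div, one_div_pow]

lemma tendsto_node {x : ℝ} (hR : ∀ n, R n = 1 ∨ R n = -1)
    (h : ∀ k, (c k : ℝ) / 2 ^ k ≤ x ∧ x ≤ ((c k + 1 : ℕ) : ℝ) / 2 ^ k) :
    Tendsto (fun k => node R k (c k)) atTop (𝓝 (takagi (fun n => (R n : ℝ)) x)) :=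
  ((continuous_takagi (cast_sign hR)).tendsto x).comp (tendsto_left h)

lemma tendsto_node_succ {x : ℝ} (hR : ∀ n, R n = 1 ∨ R n = -1)
    (h : ∀ k, (c k : ℝ) / 2 ^ k ≤ x ∧ x ≤ ((c k + 1 : ℕ) : ℝ) / 2 ^ k) :
    Tendsto (fun k => node R k (c k + 1)) atTop (𝓝 (takagi (fun n => (R n : ℝ)) x)) :=
  ((continuous_takagi (cast_sign hR)).tendsto x).comp (tendsto_right h)

lemma tendsto_chordMid {x : ℝ} (hR : ∀ n, R n = 1 ∨ R n = -1)
    (h : ∀ k, (c k : ℝ) / 2 ^ k ≤ x ∧ x ≤ ((c k + 1 : ℕ) : ℝ) / 2 ^ k) :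
    Tendsto (fun k => chordMid R k (c k)) atTop (𝓝 (takagi (fun n => (R n : ℝ)) x)) := by
  have := ((tendsto_node hR h).add (tendsto_node_succ hR h)).div_const 2
  rwa [add_self_div_two] at this

lemma chordMid_eq (hR : ∀ n, R n = 1 ∨ R n = -1) (hc : IsBranch c) (hd : IsBranch d)
    (h : ∀ k, |dySlope R k (c k)| = |dySlope R k (d k)|) (k : ℕ) :
    chordMid R k (c k) = chordMid R k (d k) := by
  induction k with
  | zero => rw [hc.zero, hd.zero]
  | succ k ih =>
    have e : ∀ b : ℕ → ℕ, IsBranch b → chordMid R (k + 1) (b (k + 1)) = chordMid R k (b k) +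
        R k * (1 - ((|dySlope R k (b k)| * |dySlope R (k + 1) (b (k + 1))| -
          |dySlope R k (b k)| ^ 2 : ℤ) : ℝ)) / 2 ^ (k + 2) := by
      intro b hb
      have h1 := dySlope_mul_dySlope_succ hR k (b (k + 1))
      rw [hb.half k] at h1
      rw [chordMid_succ hR k _ (hb.lt _), hb.half k, ← h1, sq_abs]
      push_cast
      ring
    rw [e c hc, e d hd, ih, h k, h (k + 1)]

lemma takagi_eq_of_abs_dySlope_eq {x y : ℝ} (hR : ∀ n, R n = 1 ∨ R n = -1)
    (hc : IsBranch c) (hd : IsBranch d) (h : ∀ k, |dySlope R k (c k)| = |dySlope R k (d k)|)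
    (hx : ∀ k, (c k : ℝ) / 2 ^ k ≤ x ∧ x ≤ ((c k + 1 : ℕ) : ℝ) / 2 ^ k)
    (hy : ∀ k, (d k : ℝ) / 2 ^ k ≤ y ∧ y ≤ ((d k + 1 : ℕ) : ℝ) / 2 ^ k) :
    takagi (fun n => (R n : ℝ)) x = takagi (fun n => (R n : ℝ)) y := by
  refine tendsto_nhds_unique (tendsto_chordMid hR hx) ?_
  simpa only [chordMid_eq hR hc hd h] using tendsto_chordMid hR hy

lemma abs_dySlope_le (hR : ∀ n, R n = 1 ∨ R n = -1) (hc : IsBranch c) {k : ℕ}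
    (hk : dySlope R k (c k) = 0) (n : ℕ) : |dySlope R (k + n) (c (k + n))| ≤ n := by
  induction n with
  | zero => simp [hk]
  | succ n ih =>
    have := dySlope_succ_eq hR (k + n) (c (k + n + 1))
    rw [hc.half] at this
    rw [abs_le] at ih ⊢
    push_cast
    rw [← add_assoc]
    omega

lemma abs_takagi_sub_chordMid_le {x : ℝ} (hR : ∀ n, R n = 1 ∨ R n = -1) (hc : IsBranch c)
    (hx : ∀ k, (c k : ℝ) / 2 ^ k ≤ x ∧ x ≤ ((c k + 1 : ℕ) : ℝ) / 2 ^ k)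
    {k : ℕ} (hk : dySlope R k (c k) = 0) :
    |takagi (fun n => (R n : ℝ)) x - chordMid R k (c k)| ≤ 1 / 2 ^ k := by
  have key : ∀ n : ℕ, |chordMid R (k + n) (c (k + n)) - chordMid R k (c k)| +
      (n + 2) / 2 ^ (k + n + 1) ≤ 1 / 2 ^ k := by
    intro n
    induction n with
    | zero =>
      simp only [add_zero, sub_self, abs_zero, CharP.cast_eq_zero, zero_add, pow_succ]
      apply le_of_eq
      field_simp
    | succ n ih =>
      refine le_trans ?_ ih
      have hs := abs_dySlope_le hR hc hk n
      have hstep := chordMid_succ hR (k + n) (c (k + n + 1)) (hc.lt _)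
      have hone := dySlope_succ_eq hR (k + n) (c (k + n + 1))
      rw [hc.half] at hstep hone
      have hb : |chordMid R (k + n + 1) (c (k + n + 1)) - chordMid R (k + n) (c (k + n))| ≤
          (n + 1) / 2 ^ (k + n + 2) := by
        rw [hstep, add_sub_cancel_left, abs_div, abs_mul,
          abs_of_pos (show (0 : ℝ) < 2 ^ (k + n + 2) by positivity)]
        have hR1 : |(R (k + n) : ℝ)| = 1 := by rcases hR (k + n) with h | h <;> simp [h]
        rw [hR1, one_mul]
        gcongr
        have : |1 - dySlope R (k + n) (c (k + n)) *
            (dySlope R (k + n + 1) (c (k + n + 1)) - dySlope R (k + n) (c (k + n)))| ≤ n + 1 := by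
          rw [abs_le] at hs ⊢
          rcases hone with h | h <;> rw [h] <;> constructor <;> linarith
        exact_mod_cast this
      have htri := abs_sub_le (chordMid R (k + n + 1) (c (k + n + 1)))
        (chordMid R (k + n) (c (k + n))) (chordMid R k (c k))
      have e : ((n : ℝ) + 2) / 2 ^ (k + n + 1) =
          (n + 1) / 2 ^ (k + n + 2) + (n + 1 + 2) / 2 ^ (k + n + 1 + 1) := by
        rw [pow_succ _ (k + n + 1)]
        field_simp
        ring
      rw [e]
      push_cast
      rw [← add_assoc]
      linarith
  have hlim : Tendsto (fun n => |chordMid R (n + k) (c (n + k)) - chordMid R k (c k)|) atTop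
      (𝓝 |takagi (fun n => (R n : ℝ)) x - chordMid R k (c k)|) :=
    (((tendsto_add_atTop_iff_nat k).mpr (tendsto_chordMid hR hx)).sub_const _).abs
  refine le_of_tendsto' hlim fun n => ?_
  rw [add_comm n k]
  have : (0 : ℝ) ≤ (n + 2) / 2 ^ (k + n + 1) := by positivity
  linarith [key n]

end IsBranch

end

section

open Filter Topology

open scoped Classical in
/-- The average over the dyadic intervals of level `k` of a function `g` of the slope, extended
by zero on the intervals that do not survive. -/
noncomputable def survSum (R : ℕ → ℤ) (k : ℕ) (g : ℤ → ℝ) : ℝ :=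
  ∑ i ∈ (Finset.range (2 ^ k)).filter (Survives R k), g (dySlope R k i) / 2 ^ k

variable {R : ℕ → ℤ}

lemma sum_range_two_mul {M : Type*} [AddCommMonoid M] (F : ℕ → M) (n : ℕ) :
    ∑ i ∈ Finset.range (2 * n), F i = ∑ i ∈ Finset.range n, (F (2 * i) + F (2 * i + 1)) := by
  induction n with
  | zero => simp
  | succ n ih =>
    rw [show 2 * (n + 1) = 2 * n + 1 + 1 by ring, Finset.sum_range_succ, Finset.sum_range_succ, ih,
      Finset.sum_range_succ, add_assoc]

lemma survSum_congr {g h : ℤ → ℝ} (k : ℕ) (H : ∀ d, 0 ≤ d → g d = h d) :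
    survSum R k g = survSum R k h :=
  Finset.sum_congr rfl fun i hi => by
    classical rw [H _ (Finset.mem_filter.mp hi).2.dySlope_nonneg]

lemma survSum_mono {g h : ℤ → ℝ} (k : ℕ) (H : ∀ d, 0 ≤ d → g d ≤ h d) :
    survSum R k g ≤ survSum R k h :=
  Finset.sum_le_sum fun i hi => by
    classical
    have := H _ (Finset.mem_filter.mp hi).2.dySlope_nonneg
    gcongr

lemma survSum_nonneg {g : ℤ → ℝ} (k : ℕ) (H : ∀ d, 0 ≤ d → 0 ≤ g d) : 0 ≤ survSum R k g := by
  classical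
  exact Finset.sum_nonneg fun i hi =>
    div_nonneg (H _ (Finset.mem_filter.mp hi).2.dySlope_nonneg) (by positivity)

lemma survSum_add (k : ℕ) (g h : ℤ → ℝ) :
    survSum R k (fun d => g d + h d) = survSum R k g + survSum R k h := by
  simp only [survSum, add_div, Finset.sum_add_distrib]

lemma survSum_mul (k : ℕ) (a : ℝ) (g : ℤ → ℝ) :
    survSum R k (fun d => a * g d) = a * survSum R k g := by
  simp only [survSum, Finset.mul_sum, mul_div_assoc]

lemma survSum_sum {ι : Type*} (s : Finset ι) (k : ℕ) (g : ι → ℤ → ℝ) :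
    survSum R k (fun d => ∑ m ∈ s, g m d) = ∑ m ∈ s, survSum R k (g m) := by
  simp only [survSum, Finset.sum_div]
  exact Finset.sum_comm

lemma survSum_zero (g : ℤ → ℝ) : survSum R 0 g = g 0 := by
  simp [survSum, Survives, dySlope, Finset.filter_true_of_mem]

lemma survSum_succ (hR : ∀ n, R n = 1 ∨ R n = -1) (k : ℕ) (g : ℤ → ℝ) :
    survSum R (k + 1) g =
      survSum R k fun d => (g (d + 1) + if 1 ≤ d then g (d - 1) else 0) / 2 := by
  classical
  have hp : (2 : ℝ) ^ (k + 1) = 2 * 2 ^ k := pow_succ' _ _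
  have hl : ∀ i, Survives R (k + 1) (2 * i) ↔ Survives R k i ∧ 0 ≤ dySlope R k i + R k := by
    intro i
    rw [Survives, dySlope_left, Nat.mul_div_cancel_left _ two_pos]
  have hr : ∀ i, Survives R (k + 1) (2 * i + 1) ↔ Survives R k i ∧ 0 ≤ dySlope R k i - R k := by
    intro i
    rw [Survives, dySlope_right, show (2 * i + 1) / 2 = i by omega]
  unfold survSum
  rw [Finset.sum_filter, Finset.sum_filter, pow_succ', sum_range_two_mul]
  refine Finset.sum_congr rfl fun i _ => ?_
  rw [dySlope_left, dySlope_right]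
  simp only [hl, hr]
  by_cases hs : Survives R k i
  · have h0 := hs.dySlope_nonneg
    rcases hR k with h | h <;> rw [h, hp]
    · by_cases h1 : 1 ≤ dySlope R k i
      · simp [hs, h1, show 0 ≤ dySlope R k i + 1 by omega]
        ring
      · simp [hs, h1, show 0 ≤ dySlope R k i + 1 by omega]
        ring
    · by_cases h1 : 1 ≤ dySlope R k i
      · simp [hs, h1, show 0 ≤ dySlope R k i + 1 by omega, ← sub_eq_add_neg]
        ring
      · simp [hs, h1, show 0 ≤ dySlope R k i + 1 by omega, show ¬ 0 ≤ dySlope R k i + -1 by omega]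
        ring
  · simp [hs]

lemma survSum_add_one (hR : ∀ n, R n = 1 ∨ R n = -1) (k : ℕ) :
    survSum R k (fun d => (d : ℝ) + 1) = 1 := by
  induction k with
  | zero => simp [survSum_zero]
  | succ k ih =>
    rw [survSum_succ hR]
    refine (survSum_congr k fun d hd => ?_).trans ih
    split_ifs with h
    · push_cast
      ring
    · obtain rfl : d = 0 := by omega
      norm_num

lemma survSum_min_succ (hR : ∀ n, R n = 1 ∨ R n = -1) (k M : ℕ) :
    survSum R (k + 1) (fun d => min ((d : ℝ) + 1) (M + 1)) +
      1 / 2 * survSum R k (fun d => if d = M then 1 else 0) =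
        survSum R k (fun d => min ((d : ℝ) + 1) (M + 1)) := by
  rw [survSum_succ hR, ← survSum_mul, ← survSum_add]
  refine survSum_congr k fun d hd => ?_
  have hd' : (0 : ℝ) ≤ d := by exact_mod_cast hd
  have hM : (0 : ℝ) ≤ M := Nat.cast_nonneg M
  rcases lt_trichotomy d (M : ℤ) with h | h | h
  · have h' : (d : ℝ) + 1 ≤ M := by exact_mod_cast h
    rw [if_neg h.ne, min_eq_left (b := (M : ℝ) + 1) (by push_cast; linarith),
      min_eq_left (b := (M : ℝ) + 1) (by push_cast; linarith),
      min_eq_left (b := (M : ℝ) + 1) (by linarith)]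
    split_ifs with h1
    · push_cast
      ring
    · obtain rfl : d = 0 := by omega
      norm_num
  · have h' : (d : ℝ) = M := by exact_mod_cast h
    rw [if_pos h, min_eq_right (b := (M : ℝ) + 1) (by push_cast; linarith),
      min_eq_left (b := (M : ℝ) + 1) (by push_cast; linarith),
      min_eq_left (b := (M : ℝ) + 1) (by linarith)]
    split_ifs with h1
    · push_cast
      linarith
    · obtain rfl : d = 0 := by omega
      norm_num at h' ⊢
      linarith
  · have h' : (M : ℝ) + 1 ≤ d := by exact_mod_cast h
    rw [if_neg h.ne', min_eq_right (b := (M : ℝ) + 1) (by push_cast; linarith),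
      min_eq_right (b := (M : ℝ) + 1) (by push_cast; linarith),
      min_eq_right (b := (M : ℝ) + 1) (by linarith), if_pos (by omega)]
    ring

lemma summable_survSum_indicator (hR : ∀ n, R n = 1 ∨ R n = -1) (M : ℕ) :
    Summable fun k => survSum R k (fun d => if d = M then 1 else 0) := by
  refine summable_of_sum_range_le (c := 2)
    (fun k => survSum_nonneg k fun d _ => by split_ifs <;> norm_num) fun n => ?_
  have key : 1 / 2 * ∑ k ∈ Finset.range n, survSum R k (fun d => if d = M then 1 else 0) +
      survSum R n (fun d => min ((d : ℝ) + 1) (M + 1)) = 1 := by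
    induction n with
    | zero => simp [survSum_zero]
    | succ n ih =>
      have := survSum_min_succ hR n M
      rw [Finset.sum_range_succ]
      linarith
  have : 0 ≤ survSum R n (fun d => min ((d : ℝ) + 1) (M + 1)) :=
    survSum_nonneg n fun d hd => by positivity
  linarith

lemma tendsto_survSum_one (hR : ∀ n, R n = 1 ∨ R n = -1) :
    Tendsto (fun k => survSum R k fun _ => 1) atTop (𝓝 0) := by
  have h0 : ∀ k, 0 ≤ survSum R k fun _ => 1 := fun k => survSum_nonneg k fun _ _ => zero_le_one
  have bound : ∀ M k : ℕ, (survSum R k fun _ => 1) ≤ 1 / ((M : ℝ) + 1) +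
      ∑ m ∈ Finset.range M, survSum R k (fun d => if d = m then 1 else 0) := by
    intro M k
    have e : survSum R k (fun d => 1 / ((M : ℝ) + 1) * (d + 1) +
        ∑ m ∈ Finset.range M, if d = m then 1 else 0) = 1 / ((M : ℝ) + 1) +
          ∑ m ∈ Finset.range M, survSum R k (fun d => if d = m then 1 else 0) := by
      rw [survSum_add, survSum_mul, survSum_sum, survSum_add_one hR, mul_one]
    rw [← e]
    refine survSum_mono k fun d hd => ?_
    have hd' : (0 : ℝ) ≤ d := by exact_mod_cast hd
    have hnn : ∀ m ∈ Finset.range M, (0 : ℝ) ≤ if d = (m : ℤ) then 1 else 0 :=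
      fun m _ => by split_ifs <;> norm_num
    rcases lt_or_ge d (M : ℤ) with h | h
    · have := Finset.single_le_sum hnn (Finset.mem_range.mpr (by omega : d.toNat < M))
      rw [if_pos (by omega)] at this
      have : (0 : ℝ) ≤ 1 / (M + 1) * (d + 1) := by positivity
      linarith
    · have h' : (M : ℝ) ≤ d := by exact_mod_cast h
      have h1 : 1 ≤ 1 / ((M : ℝ) + 1) * (d + 1) := by
        rw [one_div_mul_eq_div, le_div_iff₀ (by positivity)]
        linarith
      linarith [Finset.sum_nonneg hnn]
  rw [Metric.tendsto_atTop]
  intro ε hε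
  obtain ⟨M, hM⟩ := exists_nat_one_div_lt (half_pos hε)
  have hlim : Tendsto (fun k => ∑ m ∈ Finset.range M,
      survSum R k (fun d => if d = m then 1 else 0)) atTop (𝓝 0) := by
    simpa using tendsto_finsetSum (Finset.range M) fun m _ =>
      (summable_survSum_indicator hR m).tendsto_atTop_zero
  obtain ⟨N, hN⟩ := eventually_atTop.mp (hlim.eventually_lt_const (half_pos hε))
  refine ⟨N, fun k hk => ?_⟩
  rw [Real.dist_0_eq_abs, abs_of_nonneg (h0 k)]
  linarith [bound M k, hN k hk]

lemma tendsto_survSum_slope (hR : ∀ n, R n = 1 ∨ R n = -1) :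
    Tendsto (fun k => survSum R k fun d => (d : ℝ)) atTop (𝓝 1) := by
  have h : ∀ k, survSum R k (fun d => (d : ℝ)) = 1 - survSum R k fun _ => 1 := by
    intro k
    have := survSum_add (R := R) k (fun d => (d : ℝ)) fun _ => 1
    rw [survSum_add_one hR] at this
    linarith
  simpa [funext h] using (tendsto_survSum_one hR).const_sub 1

end

section

open Filter Topology

variable {R : ℕ → ℤ}

/-- The values of the signed Takagi function at dyadic points. -/
def dyadicValues (R : ℕ → ℤ) : Set ℝ := Set.range fun p : ℕ × ℕ => node R p.1 p.2

lemma countable_dyadicValues (R : ℕ → ℤ) : (dyadicValues R).Countable := Set.countable_range _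

lemma node_mem_dyadicValues (R : ℕ → ℤ) (k i : ℕ) : node R k i ∈ dyadicValues R := ⟨(k, i), rfl⟩

/-- The points with nonnegative slope sequence, which represent the local level sets. -/
def core (R : ℕ → ℤ) : Set ℝ :=
  {x ∈ Set.Ico (0 : ℝ) 1 | ∀ k, Survives R k (dyadicIndex k x)}

/-- The part of the core which lies in the level set at height `y`. -/
def coreFiber (R : ℕ → ℤ) (y : ℝ) : Set ℝ :=
  {x ∈ core R | takagi (fun n => (R n : ℝ)) x = y}

lemma isBranch_dyadicIndex {x : ℝ} (hx : x ∈ Set.Ico (0 : ℝ) 1) :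
    IsBranch fun k => dyadicIndex k x where
  zero := by simpa [dyadicIndex, Nat.floor_eq_zero] using hx.2
  half k := by
    have := Nat.floor_div_ofNat (2 ^ (k + 1) * x) 2
    unfold dyadicIndex
    rw [← this]
    congr 1
    rw [pow_succ]
    field_simp

lemma dyadicIndex_bounds {x : ℝ} (hx : 0 ≤ x) (k : ℕ) :
    (dyadicIndex k x : ℝ) / 2 ^ k ≤ x ∧ x ≤ ((dyadicIndex k x + 1 : ℕ) : ℝ) / 2 ^ k := by
  have hp : (0 : ℝ) < 2 ^ k := by positivity
  rw [div_le_iff₀ hp, le_div_iff₀ hp, mul_comm x]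
  push_cast
  exact ⟨Nat.floor_le (by positivity), (Nat.lt_floor_add_one _).le⟩

lemma dyadicIndex_eq {x y : ℝ} (hxy : takagi (fun n => (R n : ℝ)) x = y)
    (hy : y ∉ dyadicValues R) {k i : ℕ} (h1 : (i : ℝ) / 2 ^ k ≤ x)
    (h2 : x ≤ ((i + 1 : ℕ) : ℝ) / 2 ^ k) : dyadicIndex k x = i := by
  have hp : (0 : ℝ) < 2 ^ k := by positivity
  have hne : x ≠ ((i + 1 : ℕ) : ℝ) / 2 ^ k := by
    rintro rfl
    exact hy (hxy ▸ node_mem_dyadicValues R k (i + 1))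
  have h3 := lt_of_le_of_ne h2 hne
  rw [lt_div_iff₀ hp, mul_comm] at h3
  rw [div_le_iff₀ hp, mul_comm] at h1
  push_cast at h3
  exact (Nat.floor_eq_iff (by have : (0 : ℝ) ≤ i := Nat.cast_nonneg i; linarith)).mpr ⟨h1, h3⟩

lemma IsBranch.mem_Ico {c : ℕ → ℕ} (hc : IsBranch c) {x y : ℝ}
    (hxy : takagi (fun n => (R n : ℝ)) x = y) (hy : y ∉ dyadicValues R)
    (hx : ∀ k, (c k : ℝ) / 2 ^ k ≤ x ∧ x ≤ ((c k + 1 : ℕ) : ℝ) / 2 ^ k) :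
    x ∈ Set.Ico (0 : ℝ) 1 := by
  have h0 := hx 0
  simp only [hc.zero, pow_zero, div_one, Nat.cast_zero, zero_add, Nat.cast_one] at h0
  refine ⟨h0.1, lt_of_le_of_ne h0.2 ?_⟩
  rintro rfl
  have := node_mem_dyadicValues R 0 1
  rw [node, Nat.cast_one, pow_zero, div_one, hxy] at this
  exact hy this

lemma eq_of_dyadicIndex_eq {x y : ℝ} (hx : 0 ≤ x) (hy : 0 ≤ y)
    (h : ∀ k, dyadicIndex k x = dyadicIndex k y) : x = y := by
  refine tendsto_nhds_unique (IsBranch.tendsto_left (dyadicIndex_bounds hx)) ?_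
  simpa only [h] using IsBranch.tendsto_left (dyadicIndex_bounds hy)

lemma eps_eq {x : ℝ} (hx : 0 ≤ x) (k : ℕ) : eps k x = dyadicIndex k x % 2 := by
  unfold eps dyadicIndex
  rw [← Int.natCast_floor_eq_floor (by positivity)]
  omega

lemma Dfun_eq {x : ℝ} (hx : x ∈ Set.Ico (0 : ℝ) 1) (k : ℕ) :
    Dfun (fun n => (R n : ℝ)) k x = dySlope R k (dyadicIndex k x) := by
  induction k with
  | zero => simp [Dfun, dySlope]
  | succ k ih =>
    unfold Dfun at ih ⊢
    rw [Finset.sum_Icc_succ_top (by omega), ih, dySlope_succ, (isBranch_dyadicIndex hx).half k,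
      eps_eq hx.1, ← neg_one_pow_eq_pow_mod_two]
    push_cast
    rfl

lemma abs_Dfun_eq_iff {x y : ℝ} (hx : x ∈ Set.Ico (0 : ℝ) 1) (hy : y ∈ Set.Ico (0 : ℝ) 1) :
    (∀ j, 1 ≤ j → |Dfun (fun n => (R n : ℝ)) j x| = |Dfun (fun n => (R n : ℝ)) j y|) ↔
      ∀ k, |dySlope R k (dyadicIndex k x)| = |dySlope R k (dyadicIndex k y)| := by
  simp only [Dfun_eq hx, Dfun_eq hy]
  constructor
  · intro h k
    cases k with
    | zero => rfl
    | succ k => exact_mod_cast h (k + 1) (by omega)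
  · intro h j _
    exact_mod_cast h j

lemma IsBranch.survives {c : ℕ → ℕ} (hc : IsBranch c) (h : ∀ k, 0 ≤ dySlope R k (c k)) (k : ℕ) :
    Survives R k (c k) := by
  induction k with
  | zero => trivial
  | succ k ih => exact ⟨by rwa [hc.half], h _⟩

lemma IsBranch.eq_of_dySlope_eq {c d : ℕ → ℕ} (hR : ∀ n, R n = 1 ∨ R n = -1) (hc : IsBranch c)
    (hd : IsBranch d) (h : ∀ k, dySlope R k (c k) = dySlope R k (d k)) (k : ℕ) : c k = d k := by
  induction k with
  | zero => rw [hc.zero, hd.zero]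
  | succ k ih =>
    have hs := h (k + 1)
    have h1 := hc.half k
    have h2 := hd.half k
    rcases Nat.even_or_odd' (c (k + 1)) with ⟨a, ha | ha⟩ <;>
      rcases Nat.even_or_odd' (d (k + 1)) with ⟨b, hb | hb⟩
    · omega
    · obtain rfl : a = b := by omega
      rw [ha, hb, dySlope_left, dySlope_right] at hs
      rcases hR k with h | h <;> omega
    · obtain rfl : a = b := by omega
      rw [ha, hb, dySlope_left, dySlope_right] at hs
      rcases hR k with h | h <;> omega
    · omega

/-- The branch obtained from `c` by reflecting the slopes to be nonnegative. -/
def reflectedBranch (R : ℕ → ℤ) (c : ℕ → ℕ) : ℕ → ℕ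
  | 0 => 0
  | k + 1 => 2 * reflectedBranch R c k +
      if |dySlope R (k + 1) (c (k + 1))| - |dySlope R k (c k)| = R k then 0 else 1

lemma isBranch_reflectedBranch (R : ℕ → ℤ) (c : ℕ → ℕ) : IsBranch (reflectedBranch R c) where
  zero := rfl
  half k := by
    rw [reflectedBranch]
    split_ifs <;> omega

lemma IsBranch.dySlope_reflectedBranch {c : ℕ → ℕ} (hR : ∀ n, R n = 1 ∨ R n = -1)
    (hc : IsBranch c) (k : ℕ) : dySlope R k (reflectedBranch R c k) = |dySlope R k (c k)| := by
  induction k with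
  | zero => rfl
  | succ k ih =>
    have h1 := dySlope_succ_eq hR k (c (k + 1))
    rw [hc.half k] at h1
    have h2 : |dySlope R (k + 1) (c (k + 1))| = |dySlope R k (c k)| + 1 ∨
        |dySlope R (k + 1) (c (k + 1))| = |dySlope R k (c k)| - 1 := by
      rcases abs_cases (dySlope R (k + 1) (c (k + 1))) with h | h <;>
        rcases abs_cases (dySlope R k (c k)) with h' | h' <;> omega
    rw [reflectedBranch]
    split_ifs with h
    · rw [add_zero, dySlope_left, ih]
      omega
    · rw [dySlope_right, ih]
      rcases hR k with h' | h' <;> omega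

lemma encard_localLevelSetsIn (hR : ∀ n, R n = 1 ∨ R n = -1) {y : ℝ} (hy : y ∉ dyadicValues R) :
    (localLevelSetsIn (fun n => (R n : ℝ)) y).encard = (coreFiber R y).encard := by
  set cls : ℝ → Set ℝ := fun x => {x' ∈ Set.Ico (0 : ℝ) 1 | ∀ j, 1 ≤ j →
    |Dfun (fun n => (R n : ℝ)) j x'| = |Dfun (fun n => (R n : ℝ)) j x|} with hcls
  have hinj : Set.InjOn cls (coreFiber R y) := by
    intro x hx x' hx' h
    have hmem : x ∈ cls x' := h ▸ (⟨hx.1.1, fun _ _ => rfl⟩ : x ∈ cls x)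
    have habs := (abs_Dfun_eq_iff hx.1.1 hx'.1.1).mp hmem.2
    refine eq_of_dyadicIndex_eq hx.1.1.1 hx'.1.1.1 <|
      (isBranch_dyadicIndex hx.1.1).eq_of_dySlope_eq hR (isBranch_dyadicIndex hx'.1.1) fun k => ?_
    have := habs k
    rwa [abs_of_nonneg (hx.1.2 k).dySlope_nonneg, abs_of_nonneg (hx'.1.2 k).dySlope_nonneg] at this
  rw [← hinj.encard_image]
  congr 1
  ext C
  constructor
  · rintro ⟨⟨x, hx, rfl⟩, hsub⟩
    have hfx : takagi (fun n => (R n : ℝ)) x = y := (hsub ⟨hx, fun _ _ => rfl⟩).2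
    have hc := isBranch_dyadicIndex hx
    have hd := isBranch_reflectedBranch R fun k => dyadicIndex k x
    have hslope := hc.dySlope_reflectedBranch hR
    have habs : ∀ k, |dySlope R k (reflectedBranch R (fun k => dyadicIndex k x) k)| =
        |dySlope R k (dyadicIndex k x)| := fun k => by rw [hslope, abs_abs]
    obtain ⟨z, hz⟩ := hd.exists_point
    have hfz : takagi (fun n => (R n : ℝ)) z = y := hfx ▸
      hd.takagi_eq_of_abs_dySlope_eq hR hc habs hz (dyadicIndex_bounds hx.1)
    have hzI := hd.mem_Ico hfz hy hz
    have hidx : ∀ k, dyadicIndex k z = reflectedBranch R (fun k => dyadicIndex k x) k :=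
      fun k => dyadicIndex_eq hfz hy (hz k).1 (hz k).2
    refine ⟨z, ⟨⟨hzI, fun k => ?_⟩, hfz⟩, ?_⟩
    · rw [hidx]
      exact hd.survives (fun k => by rw [hslope]; exact abs_nonneg _) k
    · have hDz := (abs_Dfun_eq_iff hzI hx).mpr fun k => by rw [hidx, habs]
      ext x'
      exact and_congr_right fun _ => forall₂_congr fun j hj => by rw [hDz j hj]
  · rintro ⟨x, hx, rfl⟩
    refine ⟨⟨x, hx.1.1, rfl⟩, fun x' hx' => ⟨⟨hx'.1.1, hx'.1.2.le⟩, ?_⟩⟩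
    rw [← hx.2]
    exact (isBranch_dyadicIndex hx'.1).takagi_eq_of_abs_dySlope_eq hR
      (isBranch_dyadicIndex hx.1.1) ((abs_Dfun_eq_iff hx'.1 hx.1.1).mp hx'.2)
      (dyadicIndex_bounds hx'.1.1) (dyadicIndex_bounds hx.1.1.1)

lemma encard_eq_iSup_encard {A : Set ℝ} (hA : A ⊆ Set.Ici 0) {S : ℕ → Set ℕ}
    (h1 : ∀ k, S k ⊆ dyadicIndex k '' A) (h2 : ∀ x ∈ A, ∀ᶠ k in atTop, dyadicIndex k x ∈ S k) :
    A.encard = ⨆ k, (S k).encard := by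
  refine le_antisymm ?_ (iSup_le fun k =>
    (Set.encard_le_encard (h1 k)).trans (Set.encard_image_le _ _))
  refine ENat.forall_natCast_le_iff_le.mp fun n hn => ?_
  obtain ⟨T, hTA, hT⟩ := Set.exists_subset_encard_eq hn
  have hTfin : T.Finite := Set.finite_of_encard_eq_coe hT
  have hmem : ∀ᶠ k in atTop, ∀ x ∈ T, dyadicIndex k x ∈ S k :=
    (eventually_all_finite hTfin).mpr fun x hx => h2 x (hTA hx)
  have hsep : ∀ x ∈ T, ∀ x' ∈ T, ∀ᶠ k in atTop, dyadicIndex k x = dyadicIndex k x' → x = x' := by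
    intro x hx x' hx'
    by_cases hxx : x = x'
    · exact Eventually.of_forall fun _ _ => hxx
    · have h := IsBranch.tendsto_left (dyadicIndex_bounds (hA (hTA hx)))
      have h' := IsBranch.tendsto_left (dyadicIndex_bounds (hA (hTA hx')))
      filter_upwards [(h.sub h').eventually_ne (sub_ne_zero.mpr hxx)] with k hk he
      exact absurd (by rw [he, sub_self]) hk
  have hinj : ∀ᶠ k in atTop, ∀ x ∈ T, ∀ x' ∈ T, dyadicIndex k x = dyadicIndex k x' → x = x' :=
    (eventually_all_finite hTfin).mpr fun x hx => (eventually_all_finite hTfin).mpr (hsep x hx)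
  obtain ⟨k, hk1, hk2⟩ := (hmem.and hinj).exists
  calc (n : ℕ∞) = (dyadicIndex k '' T).encard := by
        rw [Set.InjOn.encard_image fun x hx x' hx' => hk2 x hx x' hx', hT]
    _ ≤ (S k).encard := Set.encard_le_encard (Set.image_subset_iff.mpr hk1)
    _ ≤ _ := le_iSup (fun k => (S k).encard) k

lemma coreFiber_subset (R : ℕ → ℤ) (y : ℝ) : coreFiber R y ⊆ Set.Ici 0 := fun _ hx => hx.1.1.1

end

section

open Filter Topology

variable {R : ℕ → ℤ}

lemma toENNReal_encard_setOf_lt_and (n : ℕ) (P : ℕ → Prop) [DecidablePred P] :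
    (({i | i < n ∧ P i} : Set ℕ).encard : ℝ≥0∞) =
      ∑ i ∈ Finset.range n, if P i then 1 else 0 := by
  have h : ({i | i < n ∧ P i} : Set ℕ) = ((Finset.range n).filter P : Finset ℕ) := by
    ext i
    simp
  rw [h, Set.encard_coe_eq_coe_finsetCard, Finset.sum_boole]
  simp

lemma exists_measurable_eq_encard_coreFiber (hR : ∀ n, R n = 1 ∨ R n = -1) :
    ∃ F : ℝ → ℝ≥0∞, Measurable F ∧ ∀ y ∉ dyadicValues R, F y = ((coreFiber R y).encard : ℝ≥0∞) := by
  classical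
  set J : ℕ → ℕ → Set ℝ := fun k i => Set.Icc ((i : ℝ) / 2 ^ k) (((i + 1 : ℕ) : ℝ) / 2 ^ k) with hJ
  set K : Set ℝ := ⋂ n, ⋃ i ∈ {i | i < 2 ^ n ∧ Survives R n i}, J n i with hK
  set f := takagi fun n => (R n : ℝ) with hf
  set G : ℕ → ℝ → Set ℕ := fun k y => {i | i < 2 ^ k ∧ y ∈ f '' (K ∩ J k i)} with hG
  have hclosed : IsClosed K := isClosed_iInter fun n =>
    ((Set.finite_lt_nat (2 ^ n)).subset fun i hi => hi.1).isClosed_biUnion fun i _ => isClosed_Icc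
  have hmeas : ∀ k i, MeasurableSet (f '' (K ∩ J k i)) := fun k i =>
    ((isCompact_Icc.inter_left hclosed).image (continuous_takagi (cast_sign hR))).measurableSet
  refine ⟨fun y => ((⨆ k, (G k y).encard : ℕ∞) : ℝ≥0∞), ?_, fun y hy => ?_⟩
  · simp only [ENat.toENNReal_iSup, hG, toENNReal_encard_setOf_lt_and]
    exact Measurable.iSup fun k => Finset.measurable_fun_sum _ fun i _ =>
      Measurable.ite (hmeas k i) measurable_const measurable_const
  · dsimp only
    congr 1
    refine (encard_eq_iSup_encard (coreFiber_subset R y) (fun k i hi => ?_) fun x hx => ?_).symm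
    · obtain ⟨-, x, ⟨hxK, hxJ⟩, hxy⟩ := hi
      have hsurv : ∀ n, Survives R n (dyadicIndex n x) := by
        intro n
        obtain ⟨j, hj, hxj⟩ := Set.mem_iUnion₂.mp (Set.mem_iInter.mp hxK n)
        rw [dyadicIndex_eq hxy hy hxj.1 hxj.2]
        exact hj.2
      have hx0 : 0 ≤ x := le_trans (by positivity) hxJ.1
      have hx1 : x < 1 := by
        obtain ⟨j, hj, hxj⟩ := Set.mem_iUnion₂.mp (Set.mem_iInter.mp hxK 0)
        obtain rfl : j = 0 := by simpa using hj.1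
        simpa [dyadicIndex, Nat.floor_eq_zero] using dyadicIndex_eq hxy hy hxj.1 hxj.2
      exact ⟨x, ⟨⟨⟨hx0, hx1⟩, hsurv⟩, hxy⟩, dyadicIndex_eq hxy hy hxJ.1 hxJ.2⟩
    · have hbr := isBranch_dyadicIndex hx.1.1
      refine Eventually.of_forall fun k => ⟨hbr.lt k, x, ⟨?_, dyadicIndex_bounds hx.1.1.1 k⟩, hx.2⟩
      exact Set.mem_iInter.mpr fun n => Set.mem_iUnion₂.mpr
        ⟨_, ⟨hbr.lt n, hx.1.2 n⟩, dyadicIndex_bounds hx.1.1.1 n⟩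

/-- The surviving intervals of level `k` on which the piecewise linear interpolation increases
through the height `y`. -/
def crossings (R : ℕ → ℤ) (k : ℕ) (y : ℝ) : Set ℕ :=
  {i | i < 2 ^ k ∧ Survives R k i ∧ node R k i ≤ y ∧ y < node R k (i + 1)}

lemma node_succ_two_mul_add_two (k i : ℕ) : node R (k + 1) (2 * i + 1 + 1) = node R k (i + 1) :=
  node_left k (i + 1)

lemma exists_child_mem_crossings (hR : ∀ n, R n = 1 ∨ R n = -1) {k i : ℕ} {y : ℝ}
    (hi : i ∈ crossings R k y) : ∃ c ∈ crossings R (k + 1) y, c / 2 = i := by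
  obtain ⟨hlt, hs, h1, h2⟩ := hi
  have hpos : 1 ≤ dySlope R k i := by
    have h : 0 < (dySlope R k i : ℝ) / 2 ^ k := by
      rw [← node_add_one_sub k i hlt]
      linarith
    have h' : (0 : ℝ) < dySlope R k i := by
      simpa using (div_pos_iff_of_pos_right (by positivity)).mp h
    exact_mod_cast h'
  have hl : 0 ≤ dySlope R (k + 1) (2 * i) := by
    rw [dySlope_left]
    rcases hR k with h | h <;> omega
  have hr : 0 ≤ dySlope R (k + 1) (2 * i + 1) := by
    rw [dySlope_right]
    rcases hR k with h | h <;> omega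
  have hp := pow_succ 2 k
  by_cases hy : y < node R (k + 1) (2 * i + 1)
  · refine ⟨2 * i, ⟨by omega, ⟨?_, hl⟩, by rwa [node_left], hy⟩, by omega⟩
    rwa [show 2 * i / 2 = i by omega]
  · refine ⟨2 * i + 1, ⟨by omega, ⟨?_, hr⟩, not_lt.mp hy, ?_⟩, by omega⟩
    · rwa [show (2 * i + 1) / 2 = i by omega]
    · rwa [node_succ_two_mul_add_two]

lemma encard_crossings_mono (hR : ∀ n, R n = 1 ∨ R n = -1) (y : ℝ) :
    Monotone fun k => (crossings R k y).encard := by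
  refine monotone_nat_of_le_succ fun k => ?_
  have : crossings R k y ⊆ (· / 2) '' crossings R (k + 1) y := fun i hi =>
    exists_child_mem_crossings hR hi
  exact (Set.encard_le_encard this).trans (Set.encard_image_le _ _)

lemma crossings_subset (hR : ∀ n, R n = 1 ∨ R n = -1) {y : ℝ} (hy : y ∉ dyadicValues R) (k : ℕ) :
    crossings R k y ⊆ dyadicIndex k '' coreFiber R y := by
  intro i hi
  choose! child hchild hhalf using
    fun m c (hc : c ∈ crossings R (k + m) y) => exists_child_mem_crossings hR hc
  set g : ℕ → ℕ := fun m => Nat.rec i child m with hg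
  have hmem : ∀ m, g m ∈ crossings R (k + m) y := by
    intro m
    induction m with
    | zero => exact hi
    | succ m ih => exact hchild m _ ih
  have hdiv : ∀ m j, g (m + j) / 2 ^ j = g m := by
    intro m j
    induction j with
    | zero => simp
    | succ j ih =>
      rw [pow_succ', ← Nat.div_div_eq_div_mul]
      exact (congrArg (· / 2 ^ j) (hhalf (m + j) _ (hmem (m + j)))).trans ih
  set c : ℕ → ℕ := fun n => g n / 2 ^ k with hc
  have hck : ∀ n, c (n + k) = g n := fun n => hdiv n k
  have hbr : IsBranch c :=
    { zero := Nat.div_eq_of_lt hi.1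
      half := fun n => by
        simp only [hc]
        rw [Nat.div_div_eq_div_mul, mul_comm, ← Nat.div_div_eq_div_mul]
        exact congrArg (· / 2 ^ k) (hhalf n _ (hmem n)) }
  have hsurv : ∀ n, Survives R n (c n) := fun n =>
    Survives.ancestor (by rw [add_comm]; exact (hmem n).2.1)
  obtain ⟨x, hx⟩ := hbr.exists_point
  have hmem' : ∀ n, c (n + k) ∈ crossings R (n + k) y := fun n => by
    rw [hck, add_comm]
    exact hmem n
  have hxy : takagi (fun n => (R n : ℝ)) x = y := le_antisymm
    (le_of_tendsto' ((tendsto_add_atTop_iff_nat k).mpr (IsBranch.tendsto_node hR hx))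
      fun n => (hmem' n).2.2.1)
    (ge_of_tendsto' ((tendsto_add_atTop_iff_nat k).mpr (IsBranch.tendsto_node_succ hR hx))
      fun n => (hmem' n).2.2.2.le)
  have hidx : ∀ n, dyadicIndex n x = c n := fun n => dyadicIndex_eq hxy hy (hx n).1 (hx n).2
  refine ⟨x, ⟨⟨hbr.mem_Ico hxy hy hx, fun n => by rw [hidx]; exact hsurv n⟩, hxy⟩, ?_⟩
  rw [hidx]
  exact (congrArg c (zero_add k)).symm.trans (hck 0)

lemma node_le_node_succ (hR : ∀ n, R n = 1 ∨ R n = -1) {c : ℕ → ℕ} (hc : IsBranch c) {k : ℕ}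
    (hk : 1 ≤ dySlope R k (c k)) : node R k (c k) ≤ node R (k + 1) (c (k + 1)) ∧
      node R (k + 1) (c (k + 1) + 1) ≤ node R k (c k + 1) := by
  have hlt := hc.lt k
  have hp := pow_succ 2 k
  have h2 : (0 : ℝ) < 2 ^ (k + 1) := by positivity
  have hl := node_add_one_sub (R := R) (k + 1) (2 * c k) (by omega)
  have hr := node_add_one_sub (R := R) (k + 1) (2 * c k + 1) (by omega)
  have hl0 : (0 : ℝ) ≤ dySlope R (k + 1) (2 * c k) / 2 ^ (k + 1) := by
    refine div_nonneg (Int.cast_nonneg ?_) h2.le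
    rw [dySlope_left]
    rcases hR k with h | h <;> omega
  have hr0 : (0 : ℝ) ≤ dySlope R (k + 1) (2 * c k + 1) / 2 ^ (k + 1) := by
    refine div_nonneg (Int.cast_nonneg ?_) h2.le
    rw [dySlope_right]
    rcases hR k with h | h <;> omega
  rw [node_left] at hl
  rw [node_succ_two_mul_add_two] at hr
  have hhalf := hc.half k
  rcases (by omega : c (k + 1) = 2 * c k ∨ c (k + 1) = 2 * c k + 1) with h | h
  · rw [h, node_left]
    exact ⟨le_rfl, by linarith⟩
  · rw [h, node_succ_two_mul_add_two]
    exact ⟨by linarith, le_rfl⟩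

lemma eventually_mem_crossings (hR : ∀ n, R n = 1 ∨ R n = -1) {x y : ℝ}
    (hy : y ∉ dyadicValues R) (hx : x ∈ coreFiber R y)
    (h : ∀ᶠ k in atTop, dySlope R k (dyadicIndex k x) ≠ 0) :
    ∀ᶠ k in atTop, dyadicIndex k x ∈ crossings R k y := by
  obtain ⟨K, hK⟩ := eventually_atTop.mp h
  have hbr := isBranch_dyadicIndex hx.1.1
  have hslope : ∀ k, K ≤ k → 1 ≤ dySlope R k (dyadicIndex k x) := fun k hk => by
    have := (hx.1.2 k).dySlope_nonneg
    have := hK k hk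
    omega
  have hb := dyadicIndex_bounds hx.1.1.1
  have hmono : Monotone fun n => node R (n + K) (dyadicIndex (n + K) x) :=
    monotone_nat_of_le_succ fun n => by
      have := (node_le_node_succ hR hbr (hslope (n + K) (by omega))).1
      rwa [add_right_comm] at this
  have hanti : Antitone fun n => node R (n + K) (dyadicIndex (n + K) x + 1) :=
    antitone_nat_of_succ_le fun n => by
      have := (node_le_node_succ hR hbr (hslope (n + K) (by omega))).2
      rwa [add_right_comm] at this
  have h1 := hmono.ge_of_tendsto ((tendsto_add_atTop_iff_nat K).mpr (IsBranch.tendsto_node hR hb))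
  have h2 := hanti.le_of_tendsto
    ((tendsto_add_atTop_iff_nat K).mpr (IsBranch.tendsto_node_succ hR hb))
  refine eventually_atTop.mpr ⟨K, fun k hk => ?_⟩
  obtain ⟨n, rfl⟩ := Nat.exists_eq_add_of_le' hk
  have h1 := h1 n
  have h2 := h2 n
  rw [hx.2] at h1 h2
  refine ⟨hbr.lt _, hx.1.2 _, h1, lt_of_le_of_ne h2 ?_⟩
  rintro rfl
  exact hy (node_mem_dyadicValues R _ _)

lemma ae_eventually_dySlope_ne_zero (hR : ∀ n, R n = 1 ∨ R n = -1) :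
    ∀ᵐ y : ℝ, ∀ x ∈ coreFiber R y, ∀ᶠ k in atTop, dySlope R k (dyadicIndex k x) ≠ 0 := by
  classical
  set U : ℕ → Set ℝ := fun k => ⋃ i ∈ (Finset.range (2 ^ k)).filter (Survives R k),
    {z | dySlope R k i = 0 ∧
      z ∈ Set.Icc (chordMid R k i - 1 / 2 ^ k) (chordMid R k i + 1 / 2 ^ k)} with hU
  have hvol : ∀ k, volume (U k) ≤
      ENNReal.ofReal (2 * survSum R k fun d => if d = (0 : ℕ) then 1 else 0) := by
    intro k
    refine (measure_biUnion_finset_le _ _).trans ?_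
    rw [survSum, Finset.mul_sum, ENNReal.ofReal_sum_of_nonneg fun i _ => by
      split_ifs <;> positivity]
    refine Finset.sum_le_sum fun i _ => ?_
    by_cases h : dySlope R k i = 0
    · simp only [h, true_and, Set.ofPred_mem_eq, Real.volume_Icc]
      refine ENNReal.ofReal_le_ofReal (le_of_eq ?_)
      simp
      ring
    · simp [h]
  have hsum : ∑' k, volume (U k) ≠ ∞ :=
    ne_top_of_le_ne_top ((summable_survSum_indicator hR 0).mul_left 2).tsum_ofReal_ne_top
      (ENNReal.tsum_le_tsum hvol)
  filter_upwards [ae_eventually_notMem hsum] with y hy x hx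
  filter_upwards [hy] with k hk h0
  have hbr := isBranch_dyadicIndex hx.1.1
  have hdist := IsBranch.abs_takagi_sub_chordMid_le hR hbr (dyadicIndex_bounds hx.1.1.1) h0
  rw [hx.2, abs_le] at hdist
  refine hk (Set.mem_iUnion₂.mpr ⟨dyadicIndex k x,
    Finset.mem_filter.mpr ⟨Finset.mem_range.mpr (hbr.lt k), hx.1.2 k⟩, h0, ?_, ?_⟩) <;> linarith

lemma measurable_encard_crossings (R : ℕ → ℤ) (k : ℕ) :
    Measurable fun y => ((crossings R k y).encard : ℝ≥0∞) := by
  classical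
  simp only [crossings, toENNReal_encard_setOf_lt_and]
  refine Finset.measurable_fun_sum _ fun i _ => Measurable.ite ?_ measurable_const measurable_const
  exact (MeasurableSet.const _).inter (measurableSet_Ici.inter measurableSet_Iio)

lemma lintegral_encard_crossings (R : ℕ → ℤ) (k : ℕ) :
    ∫⁻ y, ((crossings R k y).encard : ℝ≥0∞) = ENNReal.ofReal (survSum R k fun d => (d : ℝ)) := by
  classical
  have hm : ∀ i, MeasurableSet {y | Survives R k i ∧ node R k i ≤ y ∧ y < node R k (i + 1)} :=
    fun i => (MeasurableSet.const _).inter (measurableSet_Ici.inter measurableSet_Iio)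
  simp only [crossings, toENNReal_encard_setOf_lt_and]
  rw [lintegral_finsetSum _ fun i _ => Measurable.ite (hm i) measurable_const measurable_const,
    survSum, ENNReal.ofReal_sum_of_nonneg fun i hi =>
      div_nonneg (Int.cast_nonneg (Finset.mem_filter.mp hi).2.dySlope_nonneg) (by positivity),
    Finset.sum_filter]
  refine Finset.sum_congr rfl fun i hi => ?_
  by_cases hs : Survives R k i
  · rw [if_pos hs, ← node_add_one_sub k i (Finset.mem_range.mp hi), ← Real.volume_Ico,
      ← lintegral_indicator_one measurableSet_Ico]
    refine lintegral_congr fun y => ?_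
    simp [hs, Set.indicator_apply]
  · simp [hs]

lemma lintegral_encard_localLevelSetsIn (hR : ∀ n, R n = 1 ∨ R n = -1) :
    ∫⁻ y, ((localLevelSetsIn (fun n => (R n : ℝ)) y).encard : ℝ≥0∞) = 1 := by
  have hae : ∀ᵐ y : ℝ, ((localLevelSetsIn (fun n => (R n : ℝ)) y).encard : ℝ≥0∞) =
      ⨆ k, ((crossings R k y).encard : ℝ≥0∞) := by
    filter_upwards [ae_eventually_dySlope_ne_zero hR,
      (countable_dyadicValues R).ae_notMem volume] with y hslope hy
    rw [encard_localLevelSetsIn hR hy, ← ENat.toENNReal_iSup,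
      encard_eq_iSup_encard (coreFiber_subset R y) (crossings_subset hR hy)
        fun x hx => eventually_mem_crossings hR hy hx (hslope x hx)]
  have hmono : Monotone fun k y => ((crossings R k y).encard : ℝ≥0∞) := fun j k hjk y =>
    ENat.toENNReal_mono (encard_crossings_mono hR y hjk)
  rw [lintegral_congr_ae hae, lintegral_iSup (measurable_encard_crossings R) hmono]
  have hlim := ENNReal.tendsto_ofReal (tendsto_survSum_slope hR)
  simp only [← lintegral_encard_crossings, ENNReal.ofReal_one] at hlim
  exact tendsto_nhds_unique (tendsto_atTop_iSup fun j k hjk => lintegral_mono (hmono hjk)) hlim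

lemma measurable_encard_localLevelSetsIn (hR : ∀ n, R n = 1 ∨ R n = -1) :
    Measurable fun y => ((localLevelSetsIn (fun n => (R n : ℝ)) y).encard : ℝ≥0∞) := by
  obtain ⟨F, hF, hFeq⟩ := exists_measurable_eq_encard_coreFiber hR
  refine hF.measurable_of_countable_ne ((countable_dyadicValues R).mono fun y hy => ?_)
  by_contra hyR
  exact hy (by rw [hFeq y hyR, encard_localLevelSetsIn hR hyR])

end

/-- `y ↦ N_f^{loc}(y)` is measurable with `∫ N_f^{loc}(y) dy = 1`; consequently
the average number of local level sets in a level set,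
`N̄_f^{loc} = h_f⁻¹ ∫ N_f^{loc}(y) dy`, equals `h_f⁻¹`, and
`3/2 ≤ N̄_f^{loc} ≤ 2`. -/
theorem average_number_of_local_level_sets
    (r : ℕ → ℝ) (hr : ∀ n, r n = 1 ∨ r n = -1) :
    Measurable (fun y : ℝ => ((localLevelSetsIn r y).encard : ℝ≥0∞)) ∧
    (∫⁻ y : ℝ, ((localLevelSetsIn r y).encard : ℝ≥0∞) ∂volume) = 1 ∧
    (heightf r)⁻¹ * (∫⁻ y : ℝ, ((localLevelSetsIn r y).encard : ℝ≥0∞) ∂volume).toReal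
      = (heightf r)⁻¹ ∧
    3 / 2 ≤ (heightf r)⁻¹ *
        (∫⁻ y : ℝ, ((localLevelSetsIn r y).encard : ℝ≥0∞) ∂volume).toReal ∧
    (heightf r)⁻¹ *
        (∫⁻ y : ℝ, ((localLevelSetsIn r y).encard : ℝ≥0∞) ∂volume).toReal ≤ 2 := by
  obtain ⟨R, hR, rfl⟩ : ∃ R : ℕ → ℤ, (∀ n, R n = 1 ∨ R n = -1) ∧ r = fun n => (R n : ℝ) := by
    have h : ∀ n, ∃ z : ℤ, (z = 1 ∨ z = -1) ∧ r n = z := fun n => by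
      rcases hr n with h | h
      · exact ⟨1, Or.inl rfl, by simpa using h⟩
      · exact ⟨-1, Or.inr rfl, by simpa using h⟩
    choose R hR hrR using h
    exact ⟨R, hR, funext hrR⟩
  have hint := lintegral_encard_localLevelSetsIn hR
  have hlow := half_le_heightf hr
  have hupp := heightf_le hr
  refine ⟨measurable_encard_localLevelSetsIn hR, hint, ?_⟩
  rw [hint, ENNReal.toReal_one, mul_one]
  refine ⟨rfl, ?_, ?_⟩
  · rw [le_inv_comm₀ (by norm_num) (by linarith)]
    exact hupp.trans (by norm_num)
  · rw [inv_le_comm₀ (by linarith) (by norm_num)]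
    exact le_trans (by norm_num) hlow
end

section
/- For every x ∈ [0,1), f(x) = C(r) − (1/4) Σ_{n=1}^∞ (−1)^{ε_{n+1}(x)} D_n(x)/2^n, where C(r) = Σ_{n=0}^∞ r_n/2^{n+2}. -/
theorem neg_one_pow_eps_succ (n : ℕ) (x : ℝ) :
    (-1 : ℝ) ^ eps (n + 1) x = if Int.fract (2 ^ n * x) < 1 / 2 then 1 else -1 := by
  have hfr := Int.self_sub_floor ((2 : ℝ) ^ n * x)
  have h0 := Int.fract_nonneg ((2 : ℝ) ^ n * x)
  have h1 := Int.fract_lt_one ((2 : ℝ) ^ n * x)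
  unfold eps
  split_ifs with h
  · have hfl : ⌊(2 : ℝ) ^ (n + 1) * x⌋ = 2 * ⌊(2 : ℝ) ^ n * x⌋ := by
      rw [Int.floor_eq_iff, pow_succ]
      push_cast
      constructor <;> linarith
    have hmod : ⌊(2 : ℝ) ^ (n + 1) * x⌋ % 2 = 0 := by omega
    simp [hmod]
  · have hfl : ⌊(2 : ℝ) ^ (n + 1) * x⌋ = 2 * ⌊(2 : ℝ) ^ n * x⌋ + 1 := by
      rw [Int.floor_eq_iff, pow_succ]
      push_cast
      constructor <;> linarith
    have hmod : ⌊(2 : ℝ) ^ (n + 1) * x⌋ % 2 = 1 := by omega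
    simp [hmod]

theorem one_sub_two_mul_fract_two_pow_succ (n : ℕ) (x : ℝ) :
    1 - 2 * Int.fract (2 ^ (n + 1) * x) =
      2 * (1 - 2 * Int.fract (2 ^ n * x)) - (-1 : ℝ) ^ eps (n + 1) x := by
  rw [neg_one_pow_eps_succ]
  have h0 := Int.fract_nonneg ((2 : ℝ) ^ n * x)
  have h1 := Int.fract_lt_one ((2 : ℝ) ^ n * x)
  have hfr := Int.self_sub_floor ((2 : ℝ) ^ n * x)
  split_ifs with h
  · have : Int.fract ((2 : ℝ) ^ (n + 1) * x) = 2 * Int.fract (2 ^ n * x) := by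
      rw [Int.fract_eq_iff]
      refine ⟨by linarith, by linarith, 2 * ⌊(2 : ℝ) ^ n * x⌋, ?_⟩
      push_cast
      rw [pow_succ]
      linarith
    rw [this]
    ring
  · have : Int.fract ((2 : ℝ) ^ (n + 1) * x) = 2 * Int.fract (2 ^ n * x) - 1 := by
      rw [Int.fract_eq_iff]
      refine ⟨by linarith, by linarith, 2 * ⌊(2 : ℝ) ^ n * x⌋ + 1, ?_⟩
      push_cast
      rw [pow_succ]
      linarith
    rw [this]
    ring

theorem phi_two_pow_mul (n : ℕ) (x : ℝ) :
    phi (2 ^ n * x) =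
      1 / 4 - 1 / 4 * (-1 : ℝ) ^ eps (n + 1) x * (1 - 2 * Int.fract (2 ^ (n + 1) * x)) := by
  rw [one_sub_two_mul_fract_two_pow_succ, neg_one_pow_eps_succ, phi, abs_sub_round_eq_min]
  split_ifs with h
  · rw [min_eq_left (by linarith)]
    ring
  · rw [min_eq_right (by linarith)]
    ring

theorem Dfun_succ (r : ℕ → ℝ) (k : ℕ) (x : ℝ) :
    Dfun r (k + 1) x = Dfun r k x + r k * (-1 : ℝ) ^ eps (k + 1) x := by
  simp [Dfun, Finset.sum_Icc_succ_top]

theorem abs_Dfun_le {r : ℕ → ℝ} (hr : ∀ n, |r n| ≤ 1) (k : ℕ) (x : ℝ) :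
    |Dfun r k x| ≤ k := by
  refine (Finset.abs_sum_le_sum_abs _ _).trans ?_
  refine (Finset.sum_le_card_nsmul _ _ 1 fun j _ => ?_).trans (by simp)
  simpa [abs_mul] using hr (j - 1)

theorem summable_mul_Dfun_div_two_pow {r : ℕ → ℝ} (hr : ∀ n, |r n| ≤ 1) (x : ℝ) {v : ℕ → ℝ}
    (hv : ∀ n, |v n| ≤ 1) : Summable fun n => v n * Dfun r n x / 2 ^ n := by
  have hs : Summable fun n : ℕ => (n : ℝ) ^ 1 * (1 / 2) ^ n :=
    summable_pow_mul_geometric_of_norm_lt_one 1 (by norm_num)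
  refine Summable.of_norm_bounded hs fun n => ?_
  rw [Real.norm_eq_abs, abs_div, abs_mul, abs_of_pos (by positivity : (0 : ℝ) < 2 ^ n), pow_one,
    one_div, inv_pow, ← div_eq_mul_inv]
  gcongr
  calc |v n| * |Dfun r n x| ≤ 1 * n := by
        gcongr
        exacts [hv n, abs_Dfun_le hr n x]
    _ = n := one_mul _

/-- The expansion `f(x) = C(r) - (1/4) ∑_{n=1}^∞ (-1)^{ε_{n+1}(x)} D_n(x)/2^n`,
where `C(r) = ∑_{n=0}^∞ r_n/2^{n+2}` (the sum over `n ≥ 1` is reindexed by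
`n = k + 1` with `k : ℕ`). -/
theorem takagi_D_expansion (r : ℕ → ℝ) (hr : ∀ n, r n = 1 ∨ r n = -1)
    (x : ℝ) (hx : x ∈ Set.Ico (0 : ℝ) 1) :
    takagi r x = (∑' n : ℕ, r n / 2 ^ (n + 2)) -
      (1 / 4) * ∑' k : ℕ, (-1 : ℝ) ^ eps (k + 1 + 1) x * Dfun r (k + 1) x / 2 ^ (k + 1) := by
  have hr1 : ∀ n, |r n| ≤ 1 := fun n => by rcases hr n with h | h <;> simp [h]
  have hc : Summable fun n : ℕ => r n / 2 ^ (n + 2) := by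
    refine Summable.of_norm_bounded summable_geometric_two fun n => ?_
    rw [Real.norm_eq_abs, abs_div, abs_of_pos (by positivity : (0 : ℝ) < 2 ^ (n + 2)), one_div,
      inv_pow, ← one_div]
    gcongr
    exacts [hr1 n, by norm_num, by omega]
  have hb : Summable fun k : ℕ =>
      (-1 : ℝ) ^ eps (k + 1 + 1) x * Dfun r (k + 1) x / 2 ^ (k + 1) :=
    (summable_nat_add_iff 1).2 <|
      summable_mul_Dfun_div_two_pow hr1 x (v := fun n => (-1) ^ eps (n + 1) x) (by simp)
  -- The remainder terms coming from summation by parts.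
  set E : ℕ → ℝ := fun n => (1 - 2 * Int.fract (2 ^ (n + 1) * x)) * Dfun r n x / 2 ^ n with hE_def
  have hE : Summable E := summable_mul_Dfun_div_two_pow hr1 x fun n => by
    have h0 := Int.fract_nonneg ((2 : ℝ) ^ (n + 1) * x)
    have h1 := Int.fract_lt_one ((2 : ℝ) ^ (n + 1) * x)
    exact abs_le.2 ⟨by linarith, by linarith⟩
  have hE_zero : E 0 = 0 := by simp [hE_def, Dfun]
  have hE_shift : HasSum (fun n => E (n + 1)) (∑' n, E n) := by
    rw [hE.tsum_eq_zero_add, hE_zero, zero_add]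
    exact ((summable_nat_add_iff 1).2 hE).hasSum
  have hsum := (hc.hasSum.sub (hb.hasSum.mul_left (1 / 4))).sub
    ((hE_shift.sub hE.hasSum).mul_left (1 / 4))
  rw [sub_self, mul_zero, sub_zero] at hsum
  refine Eq.trans (tsum_congr fun n => ?_) hsum.tsum_eq
  have hu := one_sub_two_mul_fract_two_pow_succ (n + 1) x
  rw [phi_two_pow_mul]
  simp only [hE_def]
  rw [hu, Dfun_succ]
  generalize Int.fract ((2 : ℝ) ^ (n + 1) * x) = t
  simp only [pow_add]
  field_simp
  ring
end
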